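/- Let α ∈ ℝ and μ, λ ∈ ℂ satisfy 2 Re μ > Re λ > -1. Then P_{λ-μ}^{-μ}(tanh α) = (2^μ Γ(μ + 1/2) (cosh α)^{μ-λ} / (√π · Γ(2μ - λ) Γ(1 + λ))) · ∫_α^∞ (cosh s)^{-2μ} (sinh s - sinh α)^λ ds, with principal complex powers of positive reals. -/

import Mathlib

noncomputable def pochC (a : ℂ) (n : ℕ) : ℂ := (ascPochhammer ℂ n).eval a

/-- Ferrers function of the first kind `P_ν^μ(x)`. -/
noncomputable def ferrersP (ν μ : ℂ) (x : ℝ) : ℂ :=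
  (((1 + x) / (1 - x) : ℝ) : ℂ) ^ (μ / 2) *
    ∑' n : ℕ, pochC (-ν) n * pochC (ν + 1) n /
        (Complex.Gamma ((n : ℂ) + 1 - μ) * (n.factorial : ℂ)) *
      (((1 - x) / 2 : ℝ) : ℂ) ^ n

/-- The coefficients of the binomial series of `(1 - w) ^ (-s)`. -/
noncomputable def risingBinom (s : ℂ) (n : ℕ) : ℂ := pochC s n / (n.factorial : ℂ)

/-- The coefficients of the Gauss hypergeometric series divided by `Γ(c)`. -/
noncomputable def gaussCoeff (a b c : ℂ) (n : ℕ) : ℂ :=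
  pochC a n * pochC b n / (Complex.Gamma (c + n) * (n.factorial : ℂ))

lemma pochC_succ (a : ℂ) (n : ℕ) : pochC a (n + 1) = pochC a n * (a + n) :=
  ascPochhammer_succ_eval n a

lemma Gamma_add_natCast {a : ℂ} (ha : 0 < a.re) (n : ℕ) :
    Complex.Gamma (a + n) = Complex.Gamma a * pochC a n := by
  rw [pochC, ← Complex.Gamma_add_nat_div_Gamma_eq a, mul_div_cancel₀]
  · exact Complex.Gamma_ne_zero_of_re_pos ha
  · rintro k rfl
    simp only [Complex.neg_re, Complex.natCast_re] at ha
    linarith [k.cast_nonneg (α := ℝ)]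

lemma risingBinom_zero (s : ℂ) : risingBinom s 0 = 1 := by
  simp [risingBinom, pochC]

lemma risingBinom_succ (s : ℂ) (n : ℕ) :
    (n + 1) * risingBinom s (n + 1) = (s + n) * risingBinom s n := by
  have h : (n.factorial : ℂ) ≠ 0 := by exact_mod_cast n.factorial_ne_zero
  have h' : (n : ℂ) + 1 ≠ 0 := by exact_mod_cast n.succ_ne_zero
  rw [risingBinom, risingBinom, pochC_succ, Nat.factorial_succ]
  push_cast
  field_simp

lemma gaussCoeff_succ (a b : ℂ) {c : ℂ} (hc : 0 < c.re) (n : ℕ) :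
    (n + 1) * (c + n) * gaussCoeff a b c (n + 1) = (a + n) * (b + n) * gaussCoeff a b c n := by
  have h : (n.factorial : ℂ) ≠ 0 := by exact_mod_cast n.factorial_ne_zero
  have h' : (n : ℂ) + 1 ≠ 0 := by exact_mod_cast n.succ_ne_zero
  have hre : 0 < (c + n).re := by
    simp only [Complex.add_re, Complex.natCast_re]
    positivity
  have hcn : c + n ≠ 0 := fun h0 => by simp [h0] at hre
  have hG := Complex.Gamma_ne_zero_of_re_pos hre
  rw [gaussCoeff, gaussCoeff, pochC_succ, pochC_succ, Nat.factorial_succ, Nat.cast_succ,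
    ← add_assoc, Complex.Gamma_add_one _ hcn]
  push_cast
  field_simp

/-- The Pfaff–Saalschütz summation formula. -/
lemma sum_gaussCoeff_mul_risingBinom (a b : ℂ) {c : ℂ} (hc : 0 < c.re) (n : ℕ) :
    ∑ k ∈ Finset.range (n + 1), gaussCoeff a b c k * risingBinom (c - a - b) (n - k) =
      gaussCoeff (c - a) (c - b) c n := by
  induction n with
  | zero => simp [risingBinom_zero, gaussCoeff, pochC]
  | succ n ih =>
    have h' : (n : ℂ) + 1 ≠ 0 := by exact_mod_cast n.succ_ne_zero
    have hcn : c + n ≠ 0 := fun h0 => by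
      have := congrArg Complex.re h0
      simp only [Complex.add_re, Complex.natCast_re, Complex.zero_re] at this
      linarith [n.cast_nonneg (α := ℝ)]
    refine mul_left_cancel₀ (mul_ne_zero h' hcn) ?_
    rw [gaussCoeff_succ _ _ hc, ← ih, Finset.sum_range_succ _ (n + 1)]
    have key := Finset.sum_range_sub
      (fun k : ℕ => -(k * (c + k - 1)) * gaussCoeff a b c k * risingBinom (c - a - b) (n + 1 - k))
      (n + 1)
    have hterm : ∀ k ∈ Finset.range (n + 1),
        (n + 1) * (c + n) * (gaussCoeff a b c k * risingBinom (c - a - b) (n + 1 - k)) -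
          (c - a + n) * (c - b + n) *
            (gaussCoeff a b c k * risingBinom (c - a - b) (n - k)) =
        -((k + 1 : ℕ) * (c + (k + 1 : ℕ) - 1)) * gaussCoeff a b c (k + 1) *
            risingBinom (c - a - b) (n + 1 - (k + 1)) -
          -(k * (c + k - 1)) * gaussCoeff a b c k * risingBinom (c - a - b) (n + 1 - k) := by
      intro k hk
      obtain ⟨m, rfl⟩ := Nat.exists_eq_add_of_le (Nat.lt_succ_iff.mp (Finset.mem_range.mp hk))
      have e1 : k + m + 1 - k = m + 1 := by omega
      have e2 : k + m - k = m := by omega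
      have e3 : k + m + 1 - (k + 1) = m := by omega
      have hg := gaussCoeff_succ a b hc k
      have hr := risingBinom_succ (c - a - b) m
      have hm : (m : ℂ) + 1 ≠ 0 := by exact_mod_cast m.succ_ne_zero
      rw [e1, e2, e3]
      push_cast
      have hr' : risingBinom (c - a - b) (m + 1) =
          (c - a - b + m) * risingBinom (c - a - b) m / (m + 1) := by
        rw [← hr]; field_simp
      have hg' : -(((k : ℂ) + 1) * (c + (k + 1) - 1)) * gaussCoeff a b c (k + 1) =
          -((a + k) * (b + k) * gaussCoeff a b c k) := by
        rw [← hg]; ring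
      rw [hg', hr']
      field_simp
      ring
    rw [← Finset.sum_congr rfl hterm, Finset.sum_sub_distrib, ← Finset.mul_sum,
      ← Finset.mul_sum] at key
    push_cast at key ⊢
    simp only [Nat.sub_self, zero_mul, neg_zero, sub_zero] at key ⊢
    linear_combination key

lemma hasFPowerSeriesOnBall_risingBinom (s : ℂ) :
    HasFPowerSeriesOnBall (fun w : ℂ => (1 - w) ^ (-s))
      (FormalMultilinearSeries.ofScalars ℂ (risingBinom s)) 0 1 := by
  have h := Complex.one_div_one_sub_cpow_hasFPowerSeriesOnBall_zero s
  have hcoeff : (fun n : ℕ => Ring.choose (s + n - 1) n) = risingBinom s := by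
    funext n
    have hn : (n.factorial : ℂ) ≠ 0 := by exact_mod_cast n.factorial_ne_zero
    have := Ring.factorial_nsmul_multichoose_eq_ascPochhammer s n
    rw [Polynomial.ascPochhammer_smeval_eq_eval, nsmul_eq_mul] at this
    rw [← Ring.multichoose_eq, risingBinom, pochC, ← this]
    field_simp
  simpa only [hcoeff, one_div, ← Complex.cpow_neg] using h

lemma hasSum_risingBinom (s : ℂ) {w : ℂ} (hw : ‖w‖ < 1) :
    HasSum (fun n => risingBinom s n * w ^ n) ((1 - w) ^ (-s)) := by
  have h := (hasFPowerSeriesOnBall_risingBinom s).hasSum (y := w) (by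
    simpa [← ofReal_norm, ENNReal.ofReal_lt_one] using hw)
  simpa [FormalMultilinearSeries.ofScalars_apply_eq, mul_comm] using h

lemma summable_norm_risingBinom (s : ℂ) {w : ℂ} (hw : ‖w‖ < 1) :
    Summable (fun n => ‖risingBinom s n * w ^ n‖) :=
  (hasSum_risingBinom s hw).summable.norm

/-- The Euler transformation of the Gauss hypergeometric series. -/
lemma tsum_gaussCoeff_euler {a b c w : ℂ} (hc : 0 < c.re) (hw : ‖w‖ < 1)
    (hs : Summable fun n => gaussCoeff a b c n * w ^ n) :
    ∑' n, gaussCoeff (c - a) (c - b) c n * w ^ n =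
      (∑' n, gaussCoeff a b c n * w ^ n) * (1 - w) ^ (a + b - c) := by
  have he : a + b - c = -(c - a - b) := by ring
  rw [he, ← (hasSum_risingBinom _ hw).tsum_eq,
    tsum_mul_tsum_eq_tsum_sum_range_of_summable_norm hs.norm (summable_norm_risingBinom _ hw)]
  refine tsum_congr fun n => ?_
  rw [← sum_gaussCoeff_mul_risingBinom a b hc, Finset.sum_mul]
  refine Finset.sum_congr rfl fun k hk => ?_
  rw [← Nat.add_sub_of_le (Nat.lt_succ_iff.mp (Finset.mem_range.mp hk)), pow_add,
    Nat.add_sub_cancel_left]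
  ring

lemma risingBinom_mul_betaIntegral {p q : ℂ} (hp : 0 < p.re) (hq : 0 < q.re) (n : ℕ) :
    risingBinom ((p + q) / 2) n * 4 ^ n * Complex.betaIntegral (p + n) (q + n) =
      (Real.sqrt Real.pi : ℂ) * 2 ^ (1 - (p + q)) * Complex.Gamma p * Complex.Gamma q /
        Complex.Gamma ((p + q) / 2) * gaussCoeff p q ((p + q) / 2 + 1 / 2) n := by
  have hs : 0 < ((p + q) / 2).re := by
    rw [show (p + q) / 2 = ((1 / 2 : ℝ) : ℂ) * (p + q) by push_cast; ring, Complex.re_ofReal_mul]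
    simp only [Complex.add_re]
    linarith
  have shift : ∀ {a : ℂ}, 0 < a.re → 0 < (a + n).re := fun {a} ha => by
    simp only [Complex.add_re, Complex.natCast_re]
    positivity
  have hB := Complex.Gamma_mul_Gamma_eq_betaIntegral (shift hp) (shift hq)
  have hD := Complex.Gamma_mul_Gamma_add_half ((p + q) / 2 + n)
  have hsum : p + n + (q + n) = 2 * ((p + q) / 2 + n) := by ring
  rw [hsum, Gamma_add_natCast hp, Gamma_add_natCast hq] at hB
  have hpow : (2 : ℂ) ^ (1 - 2 * ((p + q) / 2 + n)) * 4 ^ n = 2 ^ (1 - (p + q)) := by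
    rw [show 1 - (p + q) = 1 - 2 * ((p + q) / 2 + n) + (2 * n : ℕ) by push_cast; ring,
      Complex.cpow_add _ _ two_ne_zero, Complex.cpow_natCast, pow_mul]
    norm_num
  have hG := Complex.Gamma_ne_zero_of_re_pos hs
  have hc : 0 < ((p + q) / 2 + 1 / 2).re := by
    rw [Complex.add_re]
    have : (1 / 2 : ℂ).re = 1 / 2 := by norm_num
    linarith
  have hGc := Complex.Gamma_ne_zero_of_re_pos (shift hc)
  have hG2 : Complex.Gamma (2 * ((p + q) / 2 + n)) ≠ 0 := by
    rw [← hsum]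
    exact Complex.Gamma_ne_zero_of_re_pos (by
      rw [Complex.add_re]; exact add_pos (shift hp) (shift hq))
  have hf : (n.factorial : ℂ) ≠ 0 := by exact_mod_cast n.factorial_ne_zero
  rw [Gamma_add_natCast hs, show (p + q) / 2 + n + 1 / 2 = (p + q) / 2 + 1 / 2 + n by ring] at hD
  rw [risingBinom, gaussCoeff, ← hpow]
  generalize Complex.Gamma ((p + q) / 2 + 1 / 2 + n) = G₁ at *
  generalize Complex.Gamma (2 * ((p + q) / 2 + n)) = G₂ at *
  generalize (2 : ℂ) ^ (1 - 2 * ((p + q) / 2 + n)) = P at *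
  field_simp
  refine mul_left_cancel₀ hG2 ?_
  linear_combination (Complex.betaIntegral (p + n) (q + n) * G₂) * hD -
    (G₂ * P * (Real.sqrt Real.pi : ℂ)) * hB

lemma integrableOn_beta {p q : ℂ} (hp : 0 < p.re) (hq : 0 < q.re) :
    MeasureTheory.IntegrableOn
      (fun t : ℝ => (t : ℂ) ^ (p - 1) * (1 - (t : ℂ)) ^ (q - 1)) (Set.Ioo 0 1) :=
  ((intervalIntegrable_iff_integrableOn_Ioo_of_le zero_le_one).mp
    (Complex.betaIntegral_convergent hp hq))

lemma integral_beta_mul_pow (p q : ℂ) (n : ℕ) :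
    ∫ t in Set.Ioo (0 : ℝ) 1,
        ((t * (1 - t) : ℝ) : ℂ) ^ n * ((t : ℂ) ^ (p - 1) * (1 - (t : ℂ)) ^ (q - 1)) =
      Complex.betaIntegral (p + n) (q + n) := by
  rw [Complex.betaIntegral, intervalIntegral.integral_of_le zero_le_one,
    MeasureTheory.integral_Ioc_eq_integral_Ioo]
  refine MeasureTheory.setIntegral_congr_fun measurableSet_Ioo fun t ht => ?_
  have h0 : (t : ℂ) ≠ 0 := by exact_mod_cast ht.1.ne'
  have h1 : 1 - (t : ℂ) ≠ 0 := by exact_mod_cast (sub_pos.mpr ht.2).ne'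
  rw [add_sub_right_comm, add_sub_right_comm, Complex.cpow_add _ _ h0, Complex.cpow_add _ _ h1,
    Complex.cpow_natCast, Complex.cpow_natCast]
  push_cast
  rw [mul_pow]
  ring

/-- The series expansion in `z` of an Euler-type integral. -/
lemma hasSum_gaussCoeff_integral {p q : ℂ} (hp : 0 < p.re) (hq : 0 < q.re) {z : ℝ} (hz0 : 0 < z)
    (hz1 : z < 1) :
    HasSum (fun n => (Real.sqrt Real.pi : ℂ) * 2 ^ (1 - (p + q)) * Complex.Gamma p *
        Complex.Gamma q / Complex.Gamma ((p + q) / 2) *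
          (gaussCoeff p q ((p + q) / 2 + 1 / 2) n * (z : ℂ) ^ n))
      (∫ t in Set.Ioo (0 : ℝ) 1, (1 - ((4 * z * (t * (1 - t)) : ℝ) : ℂ)) ^ (-((p + q) / 2)) *
        ((t : ℂ) ^ (p - 1) * (1 - (t : ℂ)) ^ (q - 1))) := by
  set s := (p + q) / 2 with hs
  have hI := integrableOn_beta hp hq
  have hzn : ‖(z : ℂ)‖ < 1 := by rwa [Complex.norm_real, Real.norm_of_nonneg hz0.le]
  have hmem : ∀ᵐ t ∂(MeasureTheory.volume.restrict (Set.Ioo (0 : ℝ) 1)), t ∈ Set.Ioo (0 : ℝ) 1 :=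
    MeasureTheory.ae_restrict_mem measurableSet_Ioo
  have hle : ∀ t ∈ Set.Ioo (0 : ℝ) 1,
      0 ≤ 4 * z * (t * (1 - t)) ∧ 4 * z * (t * (1 - t)) ≤ z := fun t ht => by
    have h1 : 0 < t * (1 - t) := mul_pos ht.1 (sub_pos.mpr ht.2)
    refine ⟨by positivity, ?_⟩
    nlinarith [mul_nonneg hz0.le (sq_nonneg (1 - 2 * t))]
  have key := MeasureTheory.hasSum_integral_of_dominated_convergence
    (μ := MeasureTheory.volume.restrict (Set.Ioo (0 : ℝ) 1))
    (F := fun (n : ℕ) (t : ℝ) => risingBinom s n * ((4 * z * (t * (1 - t)) : ℝ) : ℂ) ^ n *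
      ((t : ℂ) ^ (p - 1) * (1 - (t : ℂ)) ^ (q - 1)))
    (f := fun t : ℝ => (1 - ((4 * z * (t * (1 - t)) : ℝ) : ℂ)) ^ (-s) *
      ((t : ℂ) ^ (p - 1) * (1 - (t : ℂ)) ^ (q - 1)))
    (fun n t => ‖risingBinom s n * (z : ℂ) ^ n‖ *
      ‖(t : ℂ) ^ (p - 1) * (1 - (t : ℂ)) ^ (q - 1)‖)
    (fun n => (Continuous.aestronglyMeasurable (by fun_prop)).mul hI.aestronglyMeasurable)
    (fun n => by
      filter_upwards [hmem] with t ht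
      rw [norm_mul, norm_mul, norm_mul (risingBinom s n), norm_pow, norm_pow, Complex.norm_real,
        Complex.norm_real, Real.norm_of_nonneg (hle t ht).1, Real.norm_of_nonneg hz0.le]
      gcongr
      · exact (hle t ht).1
      · exact (hle t ht).2)
    (Filter.Eventually.of_forall fun t => (summable_norm_risingBinom s hzn).mul_right _)
    (by
      simp_rw [tsum_mul_right]
      exact hI.norm.const_mul _)
    (by
      filter_upwards [hmem] with t ht
      refine (hasSum_risingBinom s ?_).mul_right _
      rw [Complex.norm_real, Real.norm_of_nonneg (hle t ht).1]
      exact (hle t ht).2.trans_lt hz1)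
  refine key.congr_fun fun n => ?_
  rw [← mul_assoc, hs, ← risingBinom_mul_betaIntegral hp hq, ← integral_beta_mul_pow,
    mul_right_comm, ← MeasureTheory.integral_const_mul]
  refine MeasureTheory.integral_congr_ae (Filter.Eventually.of_forall fun t => ?_)
  simp only
  push_cast
  rw [mul_pow (4 * (z : ℂ)), mul_pow 4]
  ring

lemma image_sinh_sub_div (α : ℝ) :
    (fun s => (Real.sinh s - Real.sinh α) / (Real.sinh s - Real.sinh α + Real.cosh α)) ''
      Set.Ioi α = Set.Ioo 0 1 := by
  have hC := Real.cosh_pos α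
  ext t
  constructor
  · rintro ⟨s, hs, rfl⟩
    have hw : 0 < Real.sinh s - Real.sinh α := sub_pos.mpr (Real.sinh_lt_sinh.mpr hs)
    exact ⟨by positivity, (div_lt_one (by positivity)).mpr (by linarith)⟩
  · rintro ⟨h0, h1⟩
    have h1' : 0 < 1 - t := sub_pos.mpr h1
    refine ⟨Real.arsinh (Real.sinh α + Real.cosh α * t / (1 - t)), ?_, ?_⟩
    · rw [Set.mem_Ioi, ← Real.sinh_lt_sinh, Real.sinh_arsinh]
      exact lt_add_of_pos_right _ (by positivity)
    · simp only [Real.sinh_arsinh, add_sub_cancel_left]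
      field_simp
      ring

lemma ofReal_cpow_eq_exp {x : ℝ} (hx : 0 < x) (y : ℂ) :
    (x : ℂ) ^ y = Complex.exp (Real.log x * y) := by
  rw [Complex.cpow_def_of_ne_zero (by exact_mod_cast hx.ne'), Complex.ofReal_log hx.le]

lemma one_sub_mul_eq_cosh_sq_div {α s : ℝ}
    (h : Real.sinh s - Real.sinh α + Real.cosh α ≠ 0) :
    1 - 4 * ((1 - Real.tanh α) / 2) *
        ((Real.sinh s - Real.sinh α) / (Real.sinh s - Real.sinh α + Real.cosh α) *
          (1 - (Real.sinh s - Real.sinh α) / (Real.sinh s - Real.sinh α + Real.cosh α))) =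
      Real.cosh s ^ 2 / (Real.sinh s - Real.sinh α + Real.cosh α) ^ 2 := by
  have hC := (Real.cosh_pos α).ne'
  rw [Real.tanh_eq_sinh_div_cosh, Real.cosh_sq s]
  field_simp
  linear_combination (2 * Real.cosh α) * Real.cosh_sq α

lemma integral_cosh_cpow_mul (α : ℝ) (μ lam : ℂ) :
    ∫ s in Set.Ioi α,
        ((Real.cosh s : ℝ) : ℂ) ^ (-2 * μ) * ((Real.sinh s - Real.sinh α : ℝ) : ℂ) ^ lam =
      ((Real.cosh α : ℝ) : ℂ) ^ (lam - 2 * μ) *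
        ∫ t in Set.Ioo (0 : ℝ) 1,
          (1 - ((4 * ((1 - Real.tanh α) / 2) * (t * (1 - t)) : ℝ) : ℂ)) ^ (-(μ + 1 / 2)) *
            ((t : ℂ) ^ lam * (1 - (t : ℂ)) ^ (2 * μ - lam - 1)) := by
  have hC := Real.cosh_pos α
  have hpos : ∀ s ∈ Set.Ioi α, 0 < Real.sinh s - Real.sinh α := fun s hs =>
    sub_pos.mpr (Real.sinh_lt_sinh.mpr hs)
  have hderiv : ∀ s ∈ Set.Ioi α, HasDerivWithinAt
      (fun s => (Real.sinh s - Real.sinh α) / (Real.sinh s - Real.sinh α + Real.cosh α))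
      (Real.cosh α * Real.cosh s / (Real.sinh s - Real.sinh α + Real.cosh α) ^ 2)
      (Set.Ioi α) s := fun s hs => by
    have hw := hpos s hs
    have h1 := (Real.hasDerivAt_sinh s).sub_const (Real.sinh α)
    convert! (h1.div (h1.add_const (Real.cosh α)) (by positivity)).hasDerivWithinAt using 1
    ring
  have hinj : Set.InjOn
      (fun s => (Real.sinh s - Real.sinh α) / (Real.sinh s - Real.sinh α + Real.cosh α))
      (Set.Ioi α) := fun s hs r hr h => by
    have hw := hpos s hs
    have hv := hpos r hr
    simp only at h
    rw [div_eq_div_iff (by positivity) (by positivity)] at h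
    refine Real.sinh_injective (mul_right_cancel₀ hC.ne' ?_)
    linear_combination h
  rw [← image_sinh_sub_div α, MeasureTheory.integral_image_eq_integral_abs_deriv_smul
    measurableSet_Ioi hderiv hinj, ← MeasureTheory.integral_const_mul]
  refine MeasureTheory.setIntegral_congr_fun measurableSet_Ioi fun s hs => ?_
  have hw := hpos s hs
  have hc := Real.cosh_pos s
  have hD : 0 < Real.sinh s - Real.sinh α + Real.cosh α := by positivity
  rw [← Complex.ofReal_one, ← Complex.ofReal_sub, ← Complex.ofReal_sub,
    one_sub_mul_eq_cosh_sq_div hD.ne', abs_of_pos (by positivity), Complex.real_smul]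
  have h1 : 1 - (Real.sinh s - Real.sinh α) / (Real.sinh s - Real.sinh α + Real.cosh α) =
      Real.cosh α / (Real.sinh s - Real.sinh α + Real.cosh α) := by
    field_simp
    ring
  rw [h1]
  generalize Real.sinh s - Real.sinh α + Real.cosh α = D at *
  generalize Real.sinh s - Real.sinh α = w at *
  generalize Real.cosh α = C at *
  generalize Real.cosh s = c at *
  rw [← Complex.cpow_one ((C * c / D ^ 2 : ℝ) : ℂ)]
  rw [ofReal_cpow_eq_exp hc, ofReal_cpow_eq_exp hw, ofReal_cpow_eq_exp hC,
    ofReal_cpow_eq_exp (by positivity), ofReal_cpow_eq_exp (by positivity),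
    ofReal_cpow_eq_exp (by positivity), ofReal_cpow_eq_exp (by positivity),
    Real.log_div (by positivity) (by positivity), Real.log_div (by positivity) (by positivity),
    Real.log_div (by positivity) (by positivity), Real.log_div (by positivity) (by positivity),
    Real.log_mul hC.ne' hc.ne', Real.log_pow, Real.log_pow]
  simp only [← Complex.exp_add]
  congr 1
  push_cast
  ring

theorem stmt7 (α : ℝ) (μ lam : ℂ) (h1 : lam.re < 2 * μ.re) (h2 : -1 < lam.re) :
    ferrersP (lam - μ) (-μ) (Real.tanh α) =
      (2 : ℂ) ^ μ * Complex.Gamma (μ + 1 / 2) * ((Real.cosh α : ℝ) : ℂ) ^ (μ - lam) /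
          ((Real.sqrt Real.pi : ℂ) * Complex.Gamma (2 * μ - lam) * Complex.Gamma (1 + lam)) *
        ∫ s in Set.Ioi α,
          ((Real.cosh s : ℝ) : ℂ) ^ (-2 * μ) * ((Real.sinh s - Real.sinh α : ℝ) : ℂ) ^ lam := by
  have hC := Real.cosh_pos α
  have hp : 0 < (lam + 1).re := by
    rw [Complex.add_re, Complex.one_re]
    linarith
  have hq : 0 < (2 * μ - lam).re := by
    simpa using h1
  have hc : 0 < (μ + 1).re := by
    rw [Complex.add_re, Complex.one_re]
    linarith
  have hz : 1 - (1 - Real.tanh α) / 2 = Real.exp α / (2 * Real.cosh α) := by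
    rw [Real.tanh_eq_sinh_div_cosh, ← Real.sinh_add_cosh]
    field_simp
    ring
  have hz' : 1 - (((1 - Real.tanh α) / 2 : ℝ) : ℂ) =
      ((Real.exp α / (2 * Real.cosh α) : ℝ) : ℂ) := by
    rw [← hz, Complex.ofReal_sub, Complex.ofReal_one]
  have hratio : (1 + Real.tanh α) / (1 - Real.tanh α) = Real.exp (2 * α) := by
    have hd : 1 - Real.tanh α ≠ 0 := (sub_pos.mpr (Real.tanh_lt_one α)).ne'
    rw [div_eq_iff hd, Real.tanh_eq_sinh_div_cosh, two_mul, Real.exp_add]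
    field_simp
    rw [Real.cosh_sub_sinh, Real.cosh_add_sinh, Real.exp_neg]
    field_simp
  have hz0 : 0 < (1 - Real.tanh α) / 2 := by linarith [Real.tanh_lt_one α]
  have hz1 : (1 - Real.tanh α) / 2 < 1 := by linarith [Real.neg_one_lt_tanh α]
  have hsum := hasSum_gaussCoeff_integral hp hq hz0 hz1
  have hs : (lam + 1 + (2 * μ - lam)) / 2 = μ + 1 / 2 := by ring
  have hs' : lam + 1 + (2 * μ - lam) = 2 * μ + 1 := by ring
  rw [hs, hs', show μ + 1 / 2 + 1 / 2 = μ + 1 by ring,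
    show 1 - (2 * μ + 1) = -(2 * μ) by ring, add_sub_cancel_right] at hsum
  have hGp := Complex.Gamma_ne_zero_of_re_pos hp
  have hGq := Complex.Gamma_ne_zero_of_re_pos hq
  have hGs : Complex.Gamma (μ + 1 / 2) ≠ 0 := by
    refine Complex.Gamma_ne_zero_of_re_pos ?_
    have : (1 / 2 : ℂ).re = 1 / 2 := by norm_num
    rw [Complex.add_re]
    linarith
  have hpi : (Real.sqrt Real.pi : ℂ) ≠ 0 := by
    exact_mod_cast (Real.sqrt_pos.mpr Real.pi_pos).ne'
  have htwo : (2 : ℂ) ^ (-(2 * μ)) ≠ 0 := by simp [Complex.cpow_eq_zero_iff]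
  have hK := div_ne_zero
    (mul_ne_zero (mul_ne_zero (mul_ne_zero hpi htwo) hGp) hGq) hGs
  have hEuler := tsum_gaussCoeff_euler hc
    (by rwa [Complex.norm_real, Real.norm_of_nonneg hz0.le])
    ((summable_mul_left_iff hK).mp hsum.summable)
  rw [integral_cosh_cpow_mul, ← hsum.tsum_eq, tsum_mul_left, ferrersP, hratio]
  rw [show μ + 1 - (lam + 1) = -(lam - μ) by ring,
    show μ + 1 - (2 * μ - lam) = lam - μ + 1 by ring,
    show lam + 1 + (2 * μ - lam) - (μ + 1) = μ by ring, hz'] at hEuler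
  have hseries : (∑' n : ℕ, pochC (-(lam - μ)) n * pochC (lam - μ + 1) n /
        (Complex.Gamma ((n : ℂ) + 1 - -μ) * (n.factorial : ℂ)) *
      (((1 - Real.tanh α) / 2 : ℝ) : ℂ) ^ n) =
      ∑' n : ℕ, gaussCoeff (-(lam - μ)) (lam - μ + 1) (μ + 1) n *
        (((1 - Real.tanh α) / 2 : ℝ) : ℂ) ^ n := by
    refine tsum_congr fun n => ?_
    rw [gaussCoeff, show (n : ℂ) + 1 - -μ = μ + 1 + n by ring]
  have hprefix : ((Real.exp (2 * α) : ℝ) : ℂ) ^ (-μ / 2) *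
      ((Real.exp α / (2 * Real.cosh α) : ℝ) : ℂ) ^ μ =
      2 ^ μ * (Real.cosh α : ℂ) ^ (μ - lam) * (Real.cosh α : ℂ) ^ (lam - 2 * μ) *
        2 ^ (-(2 * μ)) := by
    have hcast_two : (2 : ℂ) = ((2 : ℝ) : ℂ) := by norm_num
    have hcast : ∀ y : ℂ, (2 : ℂ) ^ y = Complex.exp (Real.log 2 * y) := fun y => by
      rw [hcast_two, ofReal_cpow_eq_exp two_pos]
    rw [hcast, hcast, ofReal_cpow_eq_exp (Real.exp_pos _), ofReal_cpow_eq_exp (by positivity),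
      ofReal_cpow_eq_exp hC, ofReal_cpow_eq_exp hC,
      Real.log_div (Real.exp_pos _).ne' (by positivity), Real.log_mul two_ne_zero hC.ne',
      Real.log_exp, Real.log_exp]
    simp only [← Complex.exp_add]
    congr 1
    push_cast
    ring
  rw [hseries, hEuler, mul_left_comm, hprefix, add_comm 1 lam]
  generalize Complex.Gamma (μ + 1 / 2) = G at *
  field_simp
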